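/- If μ_s = μ_{s⁻¹} for every s ∈ R, then the assignment w̄ ↦ (w⁻¹)‾ for w ∈ G and e_i ↦ e_i for i ∈ P extends to a ℂ-linear anti-automorphism * of B_G(Υ) (so that *(xy) = *(y)*(x) for all x, y) satisfying * ∘ * = id. -/

import Mathlib

noncomputable section

open scoped Classical

namespace PRG

variable {V : Type*} [AddCommGroup V] [Module ℂ V]

/-- `s` is a pseudo reflection: an invertible endomorphism of finite order whose fixed
subspace is a hyperplane (a codimension one subspace). -/
def IsPRefl (s : (Module.End ℂ V)ˣ) : Prop :=
  IsOfFinOrder s ∧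
    Module.finrank ℂ (LinearMap.ker ((s : Module.End ℂ V) - 1)) + 1 = Module.finrank ℂ V

/-- The reflection hyperplane of a pseudo reflection: its fixed subspace. -/
def hypOf (s : (Module.End ℂ V)ˣ) : Submodule ℂ V :=
  LinearMap.ker ((s : Module.End ℂ V) - 1)

variable (G : Subgroup (Module.End ℂ V)ˣ)

/-- The set `R` of pseudo reflections contained in `G`. -/
def Rset : Set ↥G := {s | IsPRefl (s : (Module.End ℂ V)ˣ)}

/-- `G` is a pseudo reflection group: it is generated by the pseudo reflections it contains. -/
def IsPseudoReflectionGroup : Prop :=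
  Subgroup.closure {s : (Module.End ℂ V)ˣ | ∃ h : s ∈ G, (⟨s, h⟩ : ↥G) ∈ Rset G} = G

/-- The set `P` of reflection hyperplanes of `G`. -/
def Pset : Set (Submodule ℂ V) := (fun s : ↥G => hypOf (s : (Module.End ℂ V)ˣ)) '' Rset G

/-- The set `R(i,j)` of pseudo reflections of `G` mapping the hyperplane `j` to the
hyperplane `i`. -/
def Rij (i j : Submodule ℂ V) : Set ↥G :=
  {s | s ∈ Rset G ∧ Submodule.map ((s : (Module.End ℂ V)ˣ) : Module.End ℂ V) j = i}

/-- Conjugacy-class invariance of the parameters `μ`. -/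
def MuAdmissible (μ : ↥G → ℂ) : Prop :=
  ∀ s t : ↥G, s ∈ Rset G → t ∈ Rset G → (∃ w : ↥G, w * s * w⁻¹ = t) → μ s = μ t

/-- Orbit invariance of the parameters `m`. -/
def MAdmissible (mc : Submodule ℂ V → ℂ) : Prop :=
  ∀ i j, i ∈ Pset G → j ∈ Pset G →
    (∃ w : ↥G, Submodule.map ((w : (Module.End ℂ V)ˣ) : Module.End ℂ V) i = j) → mc i = mc j

/-- The generator `w̄` of the free algebra, for `w ∈ G`. -/
def gg (w : ↥G) : FreeAlgebra ℂ (↥G ⊕ ↥(Pset G)) := FreeAlgebra.ι ℂ (Sum.inl w)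

/-- The generator `e_i` of the free algebra, for `i ∈ P`. -/
def ee (i : ↥(Pset G)) : FreeAlgebra ℂ (↥G ⊕ ↥(Pset G)) := FreeAlgebra.ι ℂ (Sum.inr i)

/-- The defining relations of the algebra `B_G(Υ)` (Definition 5.1). -/
inductive BRel (μ : ↥G → ℂ) (mc : Submodule ℂ V → ℂ) :
    FreeAlgebra ℂ (↥G ⊕ ↥(Pset G)) → FreeAlgebra ℂ (↥G ⊕ ↥(Pset G)) → Prop
  | grp_one : BRel μ mc (gg G 1) 1
  | grp_mul (w₁ w₂ : ↥G) : BRel μ mc (gg G w₁ * gg G w₂) (gg G (w₁ * w₂))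
  | refl_e (s : ↥G) (i : ↥(Pset G)) (hs : s ∈ Rset G)
      (hhyp : hypOf (s : (Module.End ℂ V)ˣ) = (i : Submodule ℂ V)) :
      BRel μ mc (gg G s * ee G i) (ee G i)
  | e_refl (s : ↥G) (i : ↥(Pset G)) (hs : s ∈ Rset G)
      (hhyp : hypOf (s : (Module.End ℂ V)ˣ) = (i : Submodule ℂ V)) :
      BRel μ mc (ee G i * gg G s) (ee G i)
  | e_sq (i : ↥(Pset G)) : BRel μ mc (ee G i * ee G i) (mc (i : Submodule ℂ V) • ee G i)
  | move (w : ↥G) (i j : ↥(Pset G))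
      (h : Submodule.map ((w : (Module.End ℂ V)ˣ) : Module.End ℂ V) (j : Submodule ℂ V)
        = (i : Submodule ℂ V)) :
      BRel μ mc (gg G w * ee G j) (ee G i * gg G w)
  | e_comm (i j : ↥(Pset G))
      (h : {k : ↥(Pset G) | (i : Submodule ℂ V) ⊓ (j : Submodule ℂ V) ≤ (k : Submodule ℂ V)}
        = {i, j}) :
      BRel μ mc (ee G i * ee G j) (ee G j * ee G i)
  | e_sum (i j : ↥(Pset G))
      (h : {k : ↥(Pset G) | (i : Submodule ℂ V) ⊓ (j : Submodule ℂ V) ≤ (k : Submodule ℂ V)}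
        ≠ {i, j})
      (h2 : (Rij G (i : Submodule ℂ V) (j : Submodule ℂ V)).Nonempty) :
      BRel μ mc (ee G i * ee G j)
        ((∑ᶠ s ∈ Rij G (i : Submodule ℂ V) (j : Submodule ℂ V), μ s • gg G s) * ee G j)
  | e_zero (i j : ↥(Pset G))
      (h : {k : ↥(Pset G) | (i : Submodule ℂ V) ⊓ (j : Submodule ℂ V) ≤ (k : Submodule ℂ V)}
        ≠ {i, j})
      (h2 : Rij G (i : Submodule ℂ V) (j : Submodule ℂ V) = ∅) :
      BRel μ mc (ee G i * ee G j) 0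

/-- The algebra `B_G(Υ)` associated with the pseudo reflection group `G` and the
parameters `Υ = (μ, m)` (Definition 5.1). -/
def BAlg (μ : ↥G → ℂ) (mc : Submodule ℂ V → ℂ) : Type _ := RingQuot (BRel G μ mc)

instance (μ : ↥G → ℂ) (mc : Submodule ℂ V → ℂ) : Ring (BAlg G μ mc) :=
  inferInstanceAs (Ring (RingQuot (BRel G μ mc)))

instance (μ : ↥G → ℂ) (mc : Submodule ℂ V → ℂ) : Algebra ℂ (BAlg G μ mc) :=
  inferInstanceAs (Algebra ℂ (RingQuot (BRel G μ mc)))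

variable (μ : ↥G → ℂ) (mc : Submodule ℂ V → ℂ)

/-- The image `w̄ ∈ B_G(Υ)` of a group element `w ∈ G`. -/
def wbar (w : ↥G) : BAlg G μ mc := RingQuot.mkAlgHom ℂ (BRel G μ mc) (gg G w)

/-- The generator `e_i ∈ B_G(Υ)` for a reflection hyperplane `i ∈ P`. -/
def ebar (i : ↥(Pset G)) : BAlg G μ mc := RingQuot.mkAlgHom ℂ (BRel G μ mc) (ee G i)

/-- `w ↦ w̄` as a monoid homomorphism `G →* B_G(Υ)`. -/
def wbarMonoidHom : ↥G →* BAlg G μ mc where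
  toFun := wbar G μ mc
  map_one' := by
    have h := RingQuot.mkAlgHom_rel ℂ (BRel.grp_one (G := G) (μ := μ) (mc := mc))
    rw [map_one] at h
    exact h
  map_mul' w₁ w₂ := by
    have h := RingQuot.mkAlgHom_rel ℂ (BRel.grp_mul (μ := μ) (mc := mc) w₁ w₂)
    rw [map_mul] at h
    exact h.symm

/-- The natural algebra homomorphism `ℂG → B_G(Υ)` induced by `w ↦ w̄`. -/
def groupAlgebraMap : MonoidAlgebra ℂ ↥G →ₐ[ℂ] BAlg G μ mc :=
  MonoidAlgebra.lift ℂ (BAlg G μ mc) ↥G (wbarMonoidHom G μ mc)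

end PRG

namespace PRG

section anti

variable {V : Type*} [AddCommGroup V] [Module ℂ V] (G : Subgroup (Module.End ℂ V)ˣ)

theorem hypOf_inv (s : (Module.End ℂ V)ˣ) : hypOf s⁻¹ = hypOf s := by
  ext v
  simp only [hypOf, LinearMap.mem_ker, LinearMap.sub_apply, Module.End.one_apply, sub_eq_zero]
  have h1 : ((s⁻¹ : (Module.End ℂ V)ˣ) : Module.End ℂ V) ((s : Module.End ℂ V) v) = v := by
    rw [← Module.End.mul_apply, Units.inv_mul, Module.End.one_apply]
  have h2 : (s : Module.End ℂ V) (((s⁻¹ : (Module.End ℂ V)ˣ) : Module.End ℂ V) v) = v := by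
    rw [← Module.End.mul_apply, Units.mul_inv, Module.End.one_apply]
  constructor
  · intro h
    rw [h] at h2
    exact h2
  · intro h
    rw [h] at h1
    exact h1

theorem Rset_inv {s : ↥G} (hs : s ∈ Rset G) : s⁻¹ ∈ Rset G := by
  have h := hypOf_inv (s : (Module.End ℂ V)ˣ)
  unfold hypOf at h
  refine ⟨?_, ?_⟩
  · simpa using hs.1
  · have := hs.2
    rw [← h] at this
    simpa using this

theorem map_inv_of_map {w : ↥G} {i j : Submodule ℂ V}
    (h : Submodule.map ((w : (Module.End ℂ V)ˣ) : Module.End ℂ V) j = i) :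
    Submodule.map (((w⁻¹ : ↥G) : (Module.End ℂ V)ˣ) : Module.End ℂ V) i = j := by
  subst h
  have : (((w⁻¹ : ↥G) : (Module.End ℂ V)ˣ) : Module.End ℂ V) ∘ₗ
      ((w : (Module.End ℂ V)ˣ) : Module.End ℂ V) = LinearMap.id := by
    rw [← Module.End.mul_eq_comp]
    simp [Module.End.one_eq_id]
  rw [← Submodule.map_comp, this, Submodule.map_id]

theorem Rij_inv {s : ↥G} {i j : Submodule ℂ V} (h : s ∈ Rij G i j) : s⁻¹ ∈ Rij G j i :=
  ⟨Rset_inv G h.1, map_inv_of_map G h.2⟩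

variable (μ : ↥G → ℂ) (mc : Submodule ℂ V → ℂ)

theorem wbar_mul (a b : ↥G) : wbar G μ mc a * wbar G μ mc b = wbar G μ mc (a * b) :=
  ((wbarMonoidHom G μ mc).map_mul a b).symm

theorem wbar_one : wbar G μ mc 1 = 1 := (wbarMonoidHom G μ mc).map_one

theorem wbar_ebar {s : ↥G} {i : ↥(Pset G)} (hs : s ∈ Rset G)
    (h : hypOf (s : (Module.End ℂ V)ˣ) = (i : Submodule ℂ V)) :
    wbar G μ mc s * ebar G μ mc i = ebar G μ mc i := by
  have h := RingQuot.mkAlgHom_rel ℂ (BRel.refl_e (μ := μ) (mc := mc) s i hs h)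
  rw [map_mul] at h
  exact h

theorem ebar_wbar {s : ↥G} {i : ↥(Pset G)} (hs : s ∈ Rset G)
    (h : hypOf (s : (Module.End ℂ V)ˣ) = (i : Submodule ℂ V)) :
    ebar G μ mc i * wbar G μ mc s = ebar G μ mc i := by
  have h := RingQuot.mkAlgHom_rel ℂ (BRel.e_refl (μ := μ) (mc := mc) s i hs h)
  rw [map_mul] at h
  exact h

theorem ebar_sq (i : ↥(Pset G)) :
    ebar G μ mc i * ebar G μ mc i = mc (i : Submodule ℂ V) • ebar G μ mc i := by
  have h := RingQuot.mkAlgHom_rel ℂ (BRel.e_sq (μ := μ) (mc := mc) i)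
  rw [map_mul, map_smul] at h
  exact h

theorem wbar_move {w : ↥G} {i j : ↥(Pset G)}
    (h : Submodule.map ((w : (Module.End ℂ V)ˣ) : Module.End ℂ V) (j : Submodule ℂ V)
        = (i : Submodule ℂ V)) :
    wbar G μ mc w * ebar G μ mc j = ebar G μ mc i * wbar G μ mc w := by
  have h := RingQuot.mkAlgHom_rel ℂ (BRel.move (μ := μ) (mc := mc) w i j h)
  rw [map_mul, map_mul] at h
  exact h

theorem ebar_comm {i j : ↥(Pset G)}
    (h : {k : ↥(Pset G) | (i : Submodule ℂ V) ⊓ (j : Submodule ℂ V) ≤ (k : Submodule ℂ V)}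
        = {i, j}) :
    ebar G μ mc i * ebar G μ mc j = ebar G μ mc j * ebar G μ mc i := by
  have h := RingQuot.mkAlgHom_rel ℂ (BRel.e_comm (μ := μ) (mc := mc) i j h)
  rw [map_mul, map_mul] at h
  exact h

theorem ebar_zero {i j : ↥(Pset G)}
    (h : {k : ↥(Pset G) | (i : Submodule ℂ V) ⊓ (j : Submodule ℂ V) ≤ (k : Submodule ℂ V)}
        ≠ {i, j})
    (h2 : Rij G (i : Submodule ℂ V) (j : Submodule ℂ V) = ∅) :
    ebar G μ mc i * ebar G μ mc j = 0 := by
  have h := RingQuot.mkAlgHom_rel ℂ (BRel.e_zero (μ := μ) (mc := mc) i j h h2)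
  rw [map_mul, map_zero] at h
  exact h

/-- The image of the finite sum under any algebra homomorphism. -/
theorem map_sum_gg [Finite ↥G] {A : Type*} [Semiring A] [Algebra ℂ A]
    (f : FreeAlgebra ℂ (↥G ⊕ ↥(Pset G)) →ₐ[ℂ] A) (S : Set ↥G) :
    f (∑ᶠ s ∈ S, μ s • gg G s) = ∑ᶠ s ∈ S, μ s • f (gg G s) := by
  have h := AddMonoidHom.map_finsum_mem (fun s => μ s • gg G s)
    (f : FreeAlgebra ℂ (↥G ⊕ ↥(Pset G)) →+ A) (Set.toFinite S)
  simpa using h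

theorem ebar_sum [Finite ↥G] {i j : ↥(Pset G)}
    (h : {k : ↥(Pset G) | (i : Submodule ℂ V) ⊓ (j : Submodule ℂ V) ≤ (k : Submodule ℂ V)}
        ≠ {i, j})
    (h2 : (Rij G (i : Submodule ℂ V) (j : Submodule ℂ V)).Nonempty) :
    ebar G μ mc i * ebar G μ mc j =
      (∑ᶠ s ∈ Rij G (i : Submodule ℂ V) (j : Submodule ℂ V), μ s • wbar G μ mc s)
        * ebar G μ mc j := by
  have h := RingQuot.mkAlgHom_rel ℂ (BRel.e_sum (μ := μ) (mc := mc) i j h h2)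
  rw [map_mul, map_mul, map_sum_gg] at h
  exact h

/-- The anti-homomorphism on the free algebra. -/
def preStar : FreeAlgebra ℂ (↥G ⊕ ↥(Pset G)) →ₐ[ℂ] (BAlg G μ mc)ᵐᵒᵖ :=
  FreeAlgebra.lift ℂ (Sum.elim (fun w => MulOpposite.op (wbar G μ mc w⁻¹))
    (fun i => MulOpposite.op (ebar G μ mc i)))

theorem preStar_gg (w : ↥G) :
    preStar G μ mc (gg G w) = MulOpposite.op (wbar G μ mc w⁻¹) := by
  simp [preStar, gg]

theorem preStar_ee (i : ↥(Pset G)) :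
    preStar G μ mc (ee G i) = MulOpposite.op (ebar G μ mc i) := by
  simp [preStar, ee]

theorem pair_swap {i j : ↥(Pset G)} :
    ({k : ↥(Pset G) | (i : Submodule ℂ V) ⊓ (j : Submodule ℂ V) ≤ (k : Submodule ℂ V)}
        = {i, j}) ↔
    ({k : ↥(Pset G) | (j : Submodule ℂ V) ⊓ (i : Submodule ℂ V) ≤ (k : Submodule ℂ V)}
        = {j, i}) := by
  rw [inf_comm, Set.pair_comm]

theorem sum_swap [Finite ↥G] (hinv : ∀ s : ↥G, s ∈ Rset G → μ s = μ s⁻¹) (i j : ↥(Pset G)) :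
    (∑ᶠ s ∈ Rij G (j : Submodule ℂ V) (i : Submodule ℂ V), μ s • wbar G μ mc s)
        * ebar G μ mc i =
    ebar G μ mc j *
      ∑ᶠ s ∈ Rij G (i : Submodule ℂ V) (j : Submodule ℂ V), μ s • wbar G μ mc s⁻¹ := by
  have h1 := AddMonoidHom.map_finsum_mem (fun s => μ s • wbar G μ mc s)
    (AddMonoidHom.mulRight (ebar G μ mc i))
    (Set.toFinite (Rij G (j : Submodule ℂ V) (i : Submodule ℂ V)))
  have h2 := AddMonoidHom.map_finsum_mem (fun s => μ s • wbar G μ mc s⁻¹)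
    (AddMonoidHom.mulLeft (ebar G μ mc j))
    (Set.toFinite (Rij G (i : Submodule ℂ V) (j : Submodule ℂ V)))
  simp only [AddMonoidHom.coe_mulRight, AddMonoidHom.coe_mulLeft] at h1 h2
  rw [h1, h2]
  refine finsum_mem_eq_of_bijOn (fun s => s⁻¹)
    ⟨fun s hs => Rij_inv G hs, inv_injective.injOn, fun s hs => ⟨s⁻¹, Rij_inv G hs, inv_inv s⟩⟩ ?_
  intro s hs
  rw [inv_inv, smul_mul_assoc, mul_smul_comm, wbar_move G μ mc hs.2, hinv s hs.1]

theorem preStar_rel [Finite ↥G] (hinv : ∀ s : ↥G, s ∈ Rset G → μ s = μ s⁻¹)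
    {a b : FreeAlgebra ℂ (↥G ⊕ ↥(Pset G))} (h : BRel G μ mc a b) :
    preStar G μ mc a = preStar G μ mc b := by
  apply MulOpposite.unop_injective
  cases h with
  | grp_one => simp [preStar_gg, wbar_one]
  | grp_mul w₁ w₂ => simp [preStar_gg, wbar_mul]
  | refl_e s i hs hh =>
    have := ebar_wbar G μ mc (Rset_inv G hs) (i := i) (by simpa [hypOf_inv] using hh)
    simpa [preStar_gg, preStar_ee] using this
  | e_refl s i hs hh =>
    have := wbar_ebar G μ mc (Rset_inv G hs) (i := i) (by simpa [hypOf_inv] using hh)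
    simpa [preStar_gg, preStar_ee] using this
  | e_sq i => simp [preStar_ee, ebar_sq]
  | move w i j hh =>
    have := wbar_move G μ mc (map_inv_of_map G hh)
    simpa [preStar_gg, preStar_ee] using this.symm
  | e_comm i j hh =>
    simpa [preStar_ee] using (ebar_comm G μ mc hh).symm
  | e_sum i j hh h2 =>
    have h3 := ebar_sum G μ mc (fun h => hh ((pair_swap G).1 h)) (h2.imp' _ fun s hs => Rij_inv G hs)
    rw [sum_swap G μ mc hinv] at h3
    have h4 := AddMonoidHom.map_finsum_mem
      (fun s => μ s • MulOpposite.op (wbar G μ mc s⁻¹))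
      ((MulOpposite.opAddEquiv (α := BAlg G μ mc)).symm : (BAlg G μ mc)ᵐᵒᵖ →+ BAlg G μ mc)
      (Set.toFinite (Rij G (i : Submodule ℂ V) (j : Submodule ℂ V)))
    simp only [map_mul, preStar_ee, map_sum_gg, preStar_gg, MulOpposite.unop_mul,
      MulOpposite.unop_op]
    rw [h3]
    congr 1
    exact h4.symm
  | e_zero i j hh h2 =>
    have h3 := ebar_zero G μ mc (i := j) (j := i) (fun h => hh ((pair_swap G).1 h)) (by
      rw [Set.eq_empty_iff_forall_notMem] at h2 ⊢
      exact fun s hs => h2 _ (Rij_inv G hs))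
    simpa [preStar_ee] using h3

/-- The anti-homomorphism on `B_G(Υ)`. -/
def starHom [Finite ↥G] (hinv : ∀ s : ↥G, s ∈ Rset G → μ s = μ s⁻¹) :
    BAlg G μ mc →ₐ[ℂ] (BAlg G μ mc)ᵐᵒᵖ :=
  RingQuot.liftAlgHom ℂ ⟨preStar G μ mc, fun _ _ h => preStar_rel G μ mc hinv h⟩

theorem starHom_wbar [Finite ↥G] (hinv : ∀ s : ↥G, s ∈ Rset G → μ s = μ s⁻¹) (w : ↥G) :
    starHom G μ mc hinv (wbar G μ mc w) = MulOpposite.op (wbar G μ mc w⁻¹) :=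
  (RingQuot.liftAlgHom_mkAlgHom_apply ..).trans (preStar_gg G μ mc w)

theorem starHom_ebar [Finite ↥G] (hinv : ∀ s : ↥G, s ∈ Rset G → μ s = μ s⁻¹) (i : ↥(Pset G)) :
    starHom G μ mc hinv (ebar G μ mc i) = MulOpposite.op (ebar G μ mc i) :=
  (RingQuot.liftAlgHom_mkAlgHom_apply ..).trans (preStar_ee G μ mc i)

theorem BAlg_hom_ext {A : Type*} [Semiring A] [Algebra ℂ A] {f g : BAlg G μ mc →ₐ[ℂ] A}
    (hw : ∀ w, f (wbar G μ mc w) = g (wbar G μ mc w))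
    (he : ∀ i, f (ebar G μ mc i) = g (ebar G μ mc i)) : f = g := by
  refine RingQuot.ringQuot_ext' ℂ f g (FreeAlgebra.hom_ext (funext ?_))
  rintro (w | i)
  · exact hw w
  · exact he i

/-- The square of the anti-homomorphism. -/
def starSq [Finite ↥G] (hinv : ∀ s : ↥G, s ∈ Rset G → μ s = μ s⁻¹) :
    BAlg G μ mc →ₐ[ℂ] BAlg G μ mc :=
  (AlgEquiv.opOp ℂ (BAlg G μ mc)).symm.toAlgHom.comp
    ((AlgHom.op (starHom G μ mc hinv)).comp (starHom G μ mc hinv))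

theorem starSq_eq [Finite ↥G] (hinv : ∀ s : ↥G, s ∈ Rset G → μ s = μ s⁻¹) :
    starSq G μ mc hinv = AlgHom.id ℂ _ := by
  apply BAlg_hom_ext
  · intro w
    simp [starSq, starHom_wbar]
  · intro i
    simp [starSq, starHom_ebar]

end anti

end PRG

open PRG in
/-- if `μ_s = μ_{s⁻¹}` for every pseudo reflection `s ∈ R`, then
`w̄ ↦ (w⁻¹)‾`, `e_i ↦ e_i` extends to a `ℂ`-linear anti-automorphism `*` of `B_G(Υ)`
which is an involution. -/
theorem BAlg_antiInvolution
    {V : Type*} [AddCommGroup V] [Module ℂ V] [FiniteDimensional ℂ V]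
    (G : Subgroup (Module.End ℂ V)ˣ) [Finite ↥G]
    (hG : IsPseudoReflectionGroup G)
    (μ : ↥G → ℂ) (mc : Submodule ℂ V → ℂ)
    (hμ : MuAdmissible G μ) (hm : MAdmissible G mc)
    (hinv : ∀ s : ↥G, s ∈ Rset G → μ s = μ s⁻¹) :
    ∃ star : BAlg G μ mc →ₗ[ℂ] BAlg G μ mc,
      (∀ x y : BAlg G μ mc, star (x * y) = star y * star x) ∧
      (∀ x : BAlg G μ mc, star (star x) = x) ∧
      (∀ w : ↥G, star (wbar G μ mc w) = wbar G μ mc w⁻¹) ∧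
      (∀ i : ↥(Pset G), star (ebar G μ mc i) = ebar G μ mc i) := by
  refine ⟨(MulOpposite.opLinearEquiv ℂ).symm.toLinearMap ∘ₗ (starHom G μ mc hinv).toLinearMap,
    ?_, ?_, ?_, ?_⟩
  · intro x y
    simp
  · intro x
    exact DFunLike.congr_fun (starSq_eq G μ mc hinv) x
  · intro w
    simp [starHom_wbar]
  · intro i
    simp [starHom_ebar]
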